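/- Let G be a discrete group and I a nonempty set, and let T = I×G×I. The bounded linear map M_I ⊗̂ ℓ¹(G) → ℓ¹(T) determined by δ_{(i,j)} ⊗ δ_g ↦ δ_{(i,g,j)} is an isometric isomorphism of Banach algebras, where M_I ⊗̂ ℓ¹(G) carries the projective tensor product algebra structure (a ⊗ x)(b ⊗ y) = ab ⊗ xy. -/

import Mathlib

open scoped TensorProduct BigOperators ENNReal
open Filter

noncomputable section

/-- `ℓ¹(X)`: the Banach space of absolutely summable complex functions on `X`. -/
abbrev L1 (X : Type) : Type := lp (fun _ : X => ℂ) 1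

open Classical in
/-- The point mass `δ_x` in `ℓ¹(X)`. -/
noncomputable def delta {X : Type} (x : X) : L1 X := lp.single 1 x (1 : ℂ)

/-- The projective tensor norm of an element of the algebraic tensor product
`E ⊗[ℂ] F`: the infimum of `∑ ‖xᵢ‖ ‖yᵢ‖` over all finite representations
`z = ∑ xᵢ ⊗ yᵢ`. -/
def projNorm {E F : Type} [SeminormedAddCommGroup E] [NormedSpace ℂ E]
    [SeminormedAddCommGroup F] [NormedSpace ℂ F] (z : E ⊗[ℂ] F) : ℝ :=
  sInf {r : ℝ | ∃ (n : ℕ) (x : Fin n → E) (y : Fin n → F),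
    z = ∑ i, x i ⊗ₜ[ℂ] y i ∧ r = ∑ i, ‖x i‖ * ‖y i‖}

/-- `(T, φ)` is a realization of the completed projective tensor product `E ⊗̂ F`:
`T` is a Banach space, the canonical map from the algebraic tensor product is an
isometry with respect to the projective tensor norm, and it has dense range. -/
structure IsProjTensor (E F T : Type) [SeminormedAddCommGroup E] [NormedSpace ℂ E]
    [SeminormedAddCommGroup F] [NormedSpace ℂ F]
    [SeminormedAddCommGroup T] [NormedSpace ℂ T]
    (φ : E →ₗ[ℂ] F →ₗ[ℂ] T) : Prop where
  complete : CompleteSpace T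
  isometry : ∀ z : E ⊗[ℂ] F, ‖TensorProduct.lift φ z‖ = projNorm z
  dense : DenseRange ⇑(TensorProduct.lift φ)

/-- The closed linear span of the `A`-balancing relations
`{x·a ⊗ y - x ⊗ a·y}` inside a realization `T` of `E ⊗̂ F`; the quotient
`T ⧸ balancer φ r l` is the `A`-module tensor product `E ⊗̂_A F`. -/
def balancer {A E F T : Type} [SeminormedAddCommGroup E] [NormedSpace ℂ E]
    [SeminormedAddCommGroup F] [NormedSpace ℂ F]
    [SeminormedAddCommGroup T] [NormedSpace ℂ T]
    (φ : E →ₗ[ℂ] F →ₗ[ℂ] T) (r : E → A → E) (l : A → F → F) : Submodule ℂ T :=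
  (Submodule.span ℂ {z : T | ∃ (x : E) (a : A) (y : F), z = φ (r x a) y - φ x (l a y)}).topologicalClosure

/-- The Brandt semigroup `B(I,G) = (I × G × I) ∪ {∘}`, with `∘ = none`. -/
abbrev Brandt (I G : Type) : Type := Option (I × G × I)

open Classical in
/-- Multiplication of the Brandt semigroup: `(i,g,j)(i',g',j') = (i,gg',j')` if
`j = i'` and `∘` otherwise; `∘` is absorbing. -/
noncomputable instance {I G : Type} [Mul G] : Mul (Brandt I G) :=
  ⟨fun a b => match a, b with
    | some (i, g, j), some (i', g', j') => if j = i' then some (i, g * g', j') else none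
    | _, _ => none⟩

open Classical in
/-- The convolution product on `ℓ¹(S)` for a (semi)group `S`:
`(a * b)(s) = ∑_{uv = s} a(u) b(v)`. -/
noncomputable def l1conv {S : Type} [Mul S] (a b : L1 S) (s : S) : ℂ :=
  ∑' p : S × S, if p.1 * p.2 = s then a p.1 * b p.2 else 0

section Helpers

theorem l1_delta_self {X : Type} (x : X) : (delta x : L1 X) x = 1 := by
  classical
  simp [delta]

theorem l1_delta_ne {X : Type} (x y : X) (h : y ≠ x) : (delta x : L1 X) y = 0 := by
  classical
  simp [delta, h]

open Classical in
theorem l1_delta_apply {X : Type} (x y : X) :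
    (delta x : L1 X) y = if y = x then 1 else 0 := by
  split_ifs with h
  · subst h; exact l1_delta_self _
  · exact l1_delta_ne _ _ h

theorem l1_delta_norm {X : Type} (x : X) : ‖(delta x : L1 X)‖ = 1 := by
  classical
  unfold delta
  rw [lp.norm_single (by norm_num)]
  simp

theorem l1_hasSum_norm {X : Type} (a : L1 X) : HasSum (fun x => ‖a x‖) ‖a‖ := by
  have := lp.hasSum_norm (p := 1) (by simp) a
  simpa using this

theorem l1_hasSum_delta {X : Type} (a : L1 X) :
    HasSum (fun x => a x • (delta x : L1 X)) a := by
  classical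
  have := lp.hasSum_single (p := 1) (by simp) a
  convert this using 2 with x
  unfold delta
  rw [← lp.single_smul]
  simp

theorem l1_ext {X F : Type} [NormedAddCommGroup F] [NormedSpace ℂ F]
    {f g : L1 X →L[ℂ] F} (h : ∀ x, f (delta x) = g (delta x)) : f = g := by
  ext a
  have h1 := (l1_hasSum_delta a).mapL f
  have h2 := (l1_hasSum_delta a).mapL g
  simp only [map_smul, h] at h1 h2
  exact h1.unique h2

theorem l1_exists_lift {X F : Type} [NormedAddCommGroup F] [NormedSpace ℂ F] [CompleteSpace F]
    (f : X → F) (hf : ∀ x, ‖f x‖ ≤ 1) :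
    ∃ L : L1 X →L[ℂ] F, (∀ a, HasSum (fun x => a x • f x) (L a)) ∧
      (∀ x, L (delta x) = f x) ∧ ∀ a, ‖L a‖ ≤ ‖a‖ := by
  have hb : ∀ (a : L1 X) x, ‖a x • f x‖ ≤ ‖a x‖ := fun a x => by
    rw [norm_smul]
    exact mul_le_of_le_one_right (norm_nonneg _) (hf x)
  have hs : ∀ a : L1 X, Summable (fun x => a x • f x) := fun a =>
    Summable.of_norm_bounded (l1_hasSum_norm a).summable (hb a)
  have hn : ∀ a : L1 X, ‖∑' x, a x • f x‖ ≤ ‖a‖ := fun a =>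
    tsum_of_norm_bounded (l1_hasSum_norm a) (hb a)
  let L0 : L1 X →ₗ[ℂ] F :=
    { toFun := fun a => ∑' x, a x • f x
      map_add' := fun a b => by
        rw [← (hs a).tsum_add (hs b)]
        simp [add_smul]
      map_smul' := fun c a => by
        simp only [RingHom.id_apply]
        rw [← (hs a).tsum_const_smul]
        simp [mul_smul] }
  refine ⟨L0.mkContinuous 1 (fun a => by rw [one_mul]; exact hn a), fun a => (hs a).hasSum, ?_, fun a => hn a⟩
  intro x
  change ∑' y, (delta x : L1 X) y • f y = f x
  rw [tsum_eq_single x]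
  · simp [l1_delta_self]
  · intro y hy
    simp [l1_delta_ne x y hy]

theorem l1_hasSum_apply {X Z : Type} {u : X → L1 Z} {v : L1 Z} (h : HasSum u v) (z : Z) :
    HasSum (fun x => u x z) (v z) :=
  h.mapL (lp.evalCLM ℂ (fun _ : Z => ℂ) 1 z)

theorem l1_exists_bilift {X Y Z : Type} (B : X → Y → L1 Z) (hB : ∀ x y, ‖B x y‖ ≤ 1) :
    ∃ M : L1 X →L[ℂ] L1 Y →L[ℂ] L1 Z,
      (∀ a b z, M a b z = ∑' x, a x * ∑' y, b y * B x y z) ∧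
      (∀ x y, M (delta x) (delta y) = B x y) ∧ ∀ a b, ‖M a b‖ ≤ ‖a‖ * ‖b‖ := by
  choose L hL1 hL2 hL3 using fun x => l1_exists_lift (B x) (hB x)
  obtain ⟨M, hM1, hM2, hM3⟩ := l1_exists_lift L (fun x =>
    ContinuousLinearMap.opNorm_le_bound _ zero_le_one (fun a => by simpa using hL3 x a))
  refine ⟨M, ?_, ?_, ?_⟩
  · intro a b z
    have h1 := (hM1 a).mapL (ContinuousLinearMap.apply ℂ (L1 Z) b)
    have h2 := l1_hasSum_apply h1 z
    refine h2.tsum_eq.symm.trans ?_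
    refine tsum_congr fun x => ?_
    have h3 := l1_hasSum_apply (hL1 x b) z
    have h4 : ∑' y, b y * B x y z = L x b z := h3.tsum_eq
    rw [h4]
    rfl
  · intro x y
    rw [hM2, hL2]
  · intro a b
    exact (ContinuousLinearMap.le_opNorm _ _).trans
      (mul_le_mul_of_nonneg_right (hM3 a) (norm_nonneg _))

open Classical in
theorem exists_mulM (I : Type) : ∃ mulM : L1 (I × I) →L[ℂ] L1 (I × I) →L[ℂ] L1 (I × I),
    (∀ (a b : L1 (I × I)) (i j : I), mulM a b (i, j) = ∑' k : I, a (i, k) * b (k, j)) ∧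
    ∀ i j k l, mulM (delta (i, j)) (delta (k, l)) = if j = k then delta (i, l) else 0 := by
  obtain ⟨M, h1, h2, -⟩ := l1_exists_bilift
    (fun x y : I × I => if x.2 = y.1 then (delta (x.1, y.2) : L1 (I × I)) else 0)
    (fun x y => by split_ifs <;> simp [l1_delta_norm])
  refine ⟨M, ?_, fun i j k l => h2 _ _⟩
  intro a b i j
  rw [h1]
  have hin : ∀ x : I × I, (∑' y : I × I, b y *
      (if x.2 = y.1 then (delta (x.1, y.2) : L1 (I × I)) else 0) (i, j)) =
      if x.1 = i then b (x.2, j) else 0 := by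
    rintro ⟨u, k⟩
    rw [tsum_eq_single (k, j)]
    · simp [l1_delta_apply, eq_comm]
    · rintro ⟨k', j'⟩ hne
      by_cases hk : k = k'
      · subst hk
        have : j ≠ j' := fun h => hne (by rw [h])
        simp [l1_delta_apply, this]
      · simp [hk]
  simp only [hin]
  have hinj : Function.Injective (fun k : I => (i, k)) := fun k l h => by simpa using h
  rw [← hinj.tsum_eq]
  · simp
  · rintro ⟨u, k⟩ hx
    by_cases hu : u = i
    · exact ⟨k, by simp [hu]⟩
    · simp [hu] at hx

theorem exists_mulG (G : Type) [Group G] : ∃ mulG : L1 G →L[ℂ] L1 G →L[ℂ] L1 G,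
    (∀ (x y : L1 G) (g : G), mulG x y g = l1conv x y g) ∧
    ∀ g h, mulG (delta g) (delta h) = delta (g * h) := by
  classical
  obtain ⟨M, h1, h2, -⟩ := l1_exists_bilift
    (fun x y : G => (delta (x * y) : L1 G)) (fun x y => by simp [l1_delta_norm])
  refine ⟨M, ?_, fun g h => h2 _ _⟩
  intro a b g
  rw [h1]
  have hin : ∀ x : G, (∑' y : G, b y * (delta (x * y) : L1 G) g) = b (x⁻¹ * g) := by
    intro x
    rw [tsum_eq_single (x⁻¹ * g)]
    · simp [l1_delta_apply]
    · intro y hy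
      have : g ≠ x * y := fun h => hy (by simp [h])
      simp [l1_delta_apply, this]
  simp only [hin]
  unfold l1conv
  have hinj : Function.Injective (fun u : G => (u, u⁻¹ * g)) := fun k l h => by
    simpa using congrArg Prod.fst h
  rw [← hinj.tsum_eq]
  · simp
  · rintro ⟨u, k⟩ hx
    by_cases hu : u * k = g
    · exact ⟨u, by simp [← hu]⟩
    · simp [hu] at hx

open Classical in
theorem exists_mulT (I G : Type) [Group G] :
    ∃ mulT : L1 (I × G × I) →L[ℂ] L1 (I × G × I) →L[ℂ] L1 (I × G × I),
    (∀ (a b : L1 (I × G × I)) (i : I) (g : G) (j : I),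
        mulT a b (i, g, j) = ∑' p : I × G, a (i, g * p.2⁻¹, p.1) * b (p.1, p.2, j)) ∧
    ∀ i g j k h l, mulT (delta (i, g, j)) (delta (k, h, l)) =
      if j = k then delta (i, g * h, l) else 0 := by
  obtain ⟨M, h1, h2, -⟩ := l1_exists_bilift
    (fun x y : I × G × I => if x.2.2 = y.1 then
      (delta (x.1, x.2.1 * y.2.1, y.2.2) : L1 (I × G × I)) else 0)
    (fun x y => by split_ifs <;> simp [l1_delta_norm])
  refine ⟨M, ?_, fun i g j k h l => h2 _ _⟩
  intro a b i g j
  rw [h1]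
  have hin : ∀ x : I × G × I, (∑' y : I × G × I, b y *
      (if x.2.2 = y.1 then
        (delta (x.1, x.2.1 * y.2.1, y.2.2) : L1 (I × G × I)) else 0) (i, g, j)) =
      if x.1 = i then b (x.2.2, x.2.1⁻¹ * g, j) else 0 := by
    rintro ⟨u, h, k⟩
    rw [tsum_eq_single (k, h⁻¹ * g, j)]
    · simp [l1_delta_apply, eq_comm]
    · rintro ⟨k', h', j'⟩ hne
      by_cases hk : k = k'
      · subst hk
        have : ¬ (g = h * h' ∧ j = j') := by
          rintro ⟨rfl, rfl⟩
          exact hne (by simp)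
        have h3 : ¬ ((i, g, j) = (u, h * h', j')) := by
          intro h4
          simp only [Prod.mk.injEq] at h4
          exact this h4.2
        simp [l1_delta_apply, -Prod.mk.injEq, h3]
      · simp [hk]
  simp only [hin]
  have hinj : Function.Injective (fun p : I × G => (i, g * p.2⁻¹, p.1)) := by
    rintro ⟨k, h⟩ ⟨k', h'⟩ h
    simp_all
  rw [← hinj.tsum_eq]
  · simp
  · rintro ⟨u, h, k⟩ hx
    by_cases hu : u = i
    · exact ⟨(k, h⁻¹ * g), by simp [hu]⟩
    · simp [hu] at hx

theorem projNorm_bound {E F H : Type} [SeminormedAddCommGroup E] [NormedSpace ℂ E]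
    [SeminormedAddCommGroup F] [NormedSpace ℂ F] [SeminormedAddCommGroup H] [NormedSpace ℂ H]
    (Φ : E →ₗ[ℂ] F →ₗ[ℂ] H) (h : ∀ a b, ‖Φ a b‖ ≤ ‖a‖ * ‖b‖) (z : E ⊗[ℂ] F) :
    ‖TensorProduct.lift Φ z‖ ≤ projNorm z := by
  refine le_csInf ?_ ?_
  · obtain ⟨S, hS⟩ := TensorProduct.exists_finset z
    refine ⟨_, S.card, fun i => (S.equivFin.symm i).1.1, fun i => (S.equivFin.symm i).1.2, ?_, rfl⟩
    rw [hS, S.equivFin.symm.sum_comp (fun p : S => p.1.1 ⊗ₜ[ℂ] p.1.2)]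
    exact (Finset.sum_coe_sort S (fun p => p.1 ⊗ₜ[ℂ] p.2)).symm
  · rintro r ⟨n, x, y, rfl, rfl⟩
    rw [map_sum]
    refine norm_sum_le_of_le _ fun i _ => ?_
    rw [TensorProduct.lift.tmul]
    exact h _ _

theorem projNorm_tmul_le {E F : Type} [SeminormedAddCommGroup E] [NormedSpace ℂ E]
    [SeminormedAddCommGroup F] [NormedSpace ℂ F] (a : E) (b : F) :
    projNorm (a ⊗ₜ[ℂ] b) ≤ ‖a‖ * ‖b‖ := by
  refine csInf_le ⟨0, ?_⟩ ⟨1, fun _ => a, fun _ => b, by simp, by simp⟩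
  rintro r ⟨n, x, y, -, rfl⟩
  positivity

end Helpers

/-- The bounded linear map `M_I ⊗̂ ℓ¹(G) → ℓ¹(T)` (`T = I×G×I`)
determined by `δ_(i,j) ⊗ δ_g ↦ δ_(i,g,j)` is an isometric isomorphism of Banach
algebras, where `M_I ⊗̂ ℓ¹(G)` carries the projective tensor product algebra
structure `(a ⊗ x)(b ⊗ y) = ab ⊗ xy`. -/
theorem brandt_morita_stmt9 (I G : Type) [Nonempty I] [Group G] :
    ∃ (mulM : L1 (I × I) →L[ℂ] L1 (I × I) →L[ℂ] L1 (I × I))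
      (mulG : L1 G →L[ℂ] L1 G →L[ℂ] L1 G)
      (mulT : L1 (I × G × I) →L[ℂ] L1 (I × G × I) →L[ℂ] L1 (I × G × I)),
      (∀ (a b : L1 (I × I)) (i j : I), mulM a b (i, j) = ∑' k : I, a (i, k) * b (k, j)) ∧
      (∀ (x y : L1 G) (g : G), mulG x y g = l1conv x y g) ∧
      (∀ (a b : L1 (I × G × I)) (i : I) (g : G) (j : I),
        mulT a b (i, g, j) = ∑' p : I × G, a (i, g * p.2⁻¹, p.1) * b (p.1, p.2, j)) ∧
      ∀ (T1 : Type) [NormedAddCommGroup T1] [NormedSpace ℂ T1]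
        (φ : L1 (I × I) →ₗ[ℂ] L1 G →ₗ[ℂ] T1), IsProjTensor (L1 (I × I)) (L1 G) T1 φ →
        ∀ mul1 : T1 →L[ℂ] T1 →L[ℂ] T1,
          (∀ (a b : L1 (I × I)) (x y : L1 G),
            mul1 (φ a x) (φ b y) = φ (mulM a b) (mulG x y)) →
          ∃ e : T1 ≃ₗᵢ[ℂ] L1 (I × G × I),
            (∀ (i j : I) (g : G), e (φ (delta (i, j)) (delta g)) = delta (i, g, j)) ∧
            (∀ z w : T1, e (mul1 z w) = mulT (e z) (e w)) := by
  classical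
  obtain ⟨mulM, hM1, hM2⟩ := exists_mulM I
  obtain ⟨mulG, hG1, hG2⟩ := exists_mulG G
  obtain ⟨mulT, hT1, hT2⟩ := exists_mulT I G
  refine ⟨mulM, mulG, mulT, hM1, hG1, hT1, ?_⟩
  intro T1 _ _ φ hφ mul1 hmul
  haveI := hφ.complete
  have hφn : ∀ a x, ‖φ a x‖ ≤ ‖a‖ * ‖x‖ := fun a x => by
    have := hφ.isometry (a ⊗ₜ[ℂ] x)
    rw [TensorProduct.lift.tmul] at this
    rw [this]
    exact projNorm_tmul_le a x
  let φc : L1 (I × I) →L[ℂ] L1 G →L[ℂ] T1 := φ.mkContinuous₂ 1 (fun a x => by simpa using hφn a x)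
  have hφc : ∀ a x, φc a x = φ a x := fun a x => rfl
  obtain ⟨S, -, hS2, hS3⟩ := l1_exists_lift
    (fun t : I × G × I => φ (delta (t.1, t.2.2)) (delta t.2.1))
    (fun t => (hφn _ _).trans (by simp [l1_delta_norm]))
  obtain ⟨Φ, -, hΦ2, hΦ3⟩ := l1_exists_bilift
    (fun (p : I × I) (g : G) => (delta (p.1, g, p.2) : L1 (I × G × I)))
    (fun p g => by simp [l1_delta_norm])
  let Φl : L1 (I × I) →ₗ[ℂ] L1 G →ₗ[ℂ] L1 (I × G × I) := Φ.toLinearMap₁₂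
  have hΦl : ∀ a x, Φl a x = Φ a x := fun a x => rfl
  have hSΦ : ∀ a x, S (Φ a x) = φ a x := by
    have : (ContinuousLinearMap.compL ℂ _ _ _ S).comp Φ = φc := by
      refine l1_ext fun p => l1_ext fun g => ?_
      change S (Φ (delta p) (delta g)) = φ (delta p) (delta g)
      rw [hΦ2, hS2]
    intro a x
    exact DFunLike.congr_fun (DFunLike.congr_fun this a) x
  have hSlift : ∀ z, S (TensorProduct.lift Φl z) = TensorProduct.lift φ z := by
    intro z
    induction z using TensorProduct.induction_on with
    | zero => simp
    | tmul a x => rw [TensorProduct.lift.tmul, TensorProduct.lift.tmul, hΦl, hSΦ]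
    | add z w hz hw => rw [map_add, map_add, map_add, hz, hw]
  have hiso0 : ∀ z, ‖S (TensorProduct.lift Φl z)‖ = ‖TensorProduct.lift Φl z‖ := by
    intro z
    refine le_antisymm (hS3 _) ?_
    rw [hSlift, hφ.isometry]
    exact projNorm_bound Φl (fun a b => hΦ3 a b) z
  have hiso : ∀ t, ‖S t‖ = ‖t‖ := by
    intro t
    have hcl : IsClosed {t : L1 (I × G × I) | ‖S t‖ = ‖t‖} :=
      isClosed_eq (S.continuous.norm) continuous_norm
    refine hcl.mem_of_tendsto (l1_hasSum_delta t) (Eventually.of_forall fun s => ?_)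
    have : (∑ x ∈ s, t x • (delta x : L1 (I × G × I))) ∈ LinearMap.range (TensorProduct.lift Φl) := by
      refine Submodule.sum_mem _ fun x _ => Submodule.smul_mem _ _ ?_
      refine ⟨delta (x.1, x.2.2) ⊗ₜ[ℂ] delta x.2.1, ?_⟩
      rw [TensorProduct.lift.tmul, hΦl, hΦ2]
    obtain ⟨z, hz⟩ := this
    change ‖S _‖ = ‖_‖
    rw [← hz]
    exact hiso0 z
  let Si : L1 (I × G × I) →ₗᵢ[ℂ] T1 := ⟨S.toLinearMap, hiso⟩
  have hSi : ∀ t, Si t = S t := fun t => rfl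
  have hsurj : Function.Surjective Si := by
    have hc : IsClosed (Set.range Si) := Si.isometry.isClosedEmbedding.isClosed_range
    have hd : DenseRange Si := by
      refine hφ.dense.mono ?_
      rintro _ ⟨z, rfl⟩
      exact ⟨TensorProduct.lift Φl z, hSlift z⟩
    rw [← Set.range_eq_univ, ← hc.closure_eq]
    exact hd.closure_range
  let E := LinearIsometryEquiv.ofSurjective Si hsurj
  have hE : ∀ t, E t = S t := fun t => rfl
  have hmulS : ∀ s t, S (mulT s t) = mul1 (S s) (S t) := by
    have : (ContinuousLinearMap.compL ℂ _ _ _ S).comp mulT = mul1.bilinearComp S S := by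
      refine l1_ext fun p => l1_ext fun q => ?_
      obtain ⟨i, g, j⟩ := p
      obtain ⟨k, h, l⟩ := q
      change S (mulT (delta (i, g, j)) (delta (k, h, l))) =
        mul1 (S (delta (i, g, j))) (S (delta (k, h, l)))
      rw [hS2, hS2, hT2, hmul, hM2, hG2]
      split_ifs
      · rw [hS2]
      · simp
    intro s t
    exact DFunLike.congr_fun (DFunLike.congr_fun this s) t
  refine ⟨E.symm, ?_, ?_⟩
  · intro i j g
    rw [LinearIsometryEquiv.symm_apply_eq, hE, hS2]
  · intro z w
    rw [LinearIsometryEquiv.symm_apply_eq, hE, hmulS, ← hE, ← hE]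
    simp
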